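/- arXiv:2304.09815 — 2 statements merged into one kernel-verified Lean document; each statement's English description precedes it below -/
import Mathlib

section
/- Let 0 < a < 1 with a an algebraic real number, and let x be a nonzero algebraic real number. If w is a real number satisfying sinh(a·w)·e^w = x, then w is transcendental (over ℚ). -/
open Polynomial in
theorem exists_int_poly_forall_aeval_eq_zero {K : Type*} [Field K] [Algebra.IsAlgebraic ℤ K]
    (s : Finset K) (hs : ∀ β ∈ s, β ≠ 0) :
    ∃ f : ℤ[X], f.eval 0 ≠ 0 ∧ ∀ β ∈ s, aeval β f = 0 := by
  have key (β : K) (hβ : β ≠ 0) : ∃ q : ℤ[X], q.coeff 0 ≠ 0 ∧ aeval β q = 0 :=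
    (Algebra.IsAlgebraic.isAlgebraic β).exists_nonzero_coeff_and_aeval_eq_zero
      (mem_nonZeroDivisors_of_ne_zero hβ)
  choose! q hq0 hq using key
  refine ⟨∏ β ∈ s, q β, ?_, fun β hβ ↦ ?_⟩
  · rw [eval_prod, Finset.prod_ne_zero_iff]
    intro β hβ
    simpa [coeff_zero_eq_eval_zero] using hq0 β (hs β hβ)
  · rw [map_prod]
    exact Finset.prod_eq_zero hβ (hq β (hs β hβ))

open Polynomial in
theorem Polynomial.isIntegral_pow_mul_aeval {K : Type*} [Field K] {L : ℤ} {β : K}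
    (hβ : IsIntegral ℤ (L • β)) {g : ℤ[X]} {k : ℕ} (hg : g.natDegree ≤ k) :
    IsIntegral ℤ ((L : K) ^ k * aeval β g) := by
  rw [aeval_eq_sum_range' (Nat.lt_succ_of_le hg), Finset.mul_sum]
  refine IsIntegral.sum _ fun i hi ↦ ?_
  have hik : i ≤ k := Nat.lt_succ_iff.mp (Finset.mem_range.mp hi)
  have : (L : K) ^ k * (g.coeff i • β ^ i) =
      ((g.coeff i * L ^ (k - i) : ℤ) : K) * (L • β) ^ i := by
    rw [← Nat.sub_add_cancel hik, pow_add, zsmul_eq_mul, zsmul_eq_mul, Nat.add_sub_cancel, mul_pow]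
    push_cast
    ring
  rw [this]
  exact (isIntegral_algebraMap (R := ℤ) (A := K) (x := g.coeff i * L ^ (k - i))).mul (hβ.pow i)

theorem exists_int_cast_eq_of_isIntegral_of_fixed {K : Type*} [Field K] [NumberField K]
    [IsGalois ℚ K] {x : K} (hx : IsIntegral ℤ x) (hfix : ∀ σ : Gal(K/ℚ), σ x = x) :
    ∃ z : ℤ, (z : K) = x := by
  obtain ⟨q, rfl⟩ := (IsGalois.mem_range_algebraMap_iff_fixed x).mpr hfix
  obtain ⟨z, rfl⟩ := IsIntegrallyClosed.isIntegral_iff.mp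
    ((isIntegral_algebraMap_iff (algebraMap ℚ K).injective).mp hx)
  exact ⟨z, by simp⟩

open Filter Topology Nat in
theorem tendsto_const_mul_pow_mul_pow_div_factorial_pred (A B C : ℝ) (d : ℕ) :
    Tendsto (fun p : ℕ ↦ A ^ (p * d) * (B * (C ^ p / (p - 1)!))) atTop (𝓝 0) := by
  rw [← tendsto_add_atTop_iff_nat 1]
  have := (FloorSemiring.tendsto_pow_div_factorial_atTop (A ^ d * C)).const_mul (A ^ d * B * C)
  rw [mul_zero] at this
  refine this.congr fun n ↦ ?_
  simp only [Nat.add_sub_cancel]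
  ring

open Polynomial Complex in
/-- The arithmetic core of the Lindemann–Weierstrass theorem, for a Galois-equivariant family of
integral coefficients whose constant term is a nonzero integer. -/
theorem add_sum_mul_exp_ne_zero_of_isIntegral {K : Type*} [Field K] [NumberField K]
    [IsGalois ℚ K] (φ : K →+* ℂ) (s : Finset K) (hs0 : ∀ β ∈ s, β ≠ 0)
    (hs : ∀ σ : Gal(K/ℚ), ∀ β ∈ s, σ β ∈ s) (b : K → K) (hb : ∀ β ∈ s, IsIntegral ℤ (b β))
    (hbσ : ∀ σ : Gal(K/ℚ), ∀ β ∈ s, b (σ β) = σ (b β)) (m : ℤ) (hm : m ≠ 0) :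
    (m : ℂ) + ∑ β ∈ s, φ (b β) * exp (φ β) ≠ 0 := by
  intro h0
  have : Algebra.IsAlgebraic ℤ K :=
    (IsFractionRing.comap_isAlgebraic_iff (A := ℤ) (K := ℚ)).mpr inferInstance
  obtain ⟨L, hL0, hL⟩ := Algebra.IsAlgebraic.exists_integral_multiples ℤ s
  obtain ⟨f, hf0, hf⟩ := exists_int_poly_forall_aeval_eq_zero s hs0
  have hfne : f ≠ 0 := by rintro rfl; simp at hf0
  obtain ⟨c, hc⟩ := LindemannWeierstrass.exp_polynomial_approx f hf0
  have htend := tendsto_const_mul_pow_mul_pow_div_factorial_pred |(L : ℝ)|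
    (∑ β ∈ s, ‖φ (b β)‖) c f.natDegree
  obtain ⟨N, hN⟩ := Filter.eventually_atTop.mp (htend.eventually_lt_const one_pos)
  obtain ⟨p, hpN, hp⟩ :=
    Nat.exists_infinite_primes (N + (f.eval 0).natAbs + L.natAbs + m.natAbs + 1)
  specialize hN p (by omega)
  obtain ⟨n, hpn, g, hg, happ⟩ := hc p (by omega) hp
  have hpI : Prime (p : ℤ) := Nat.prime_iff_prime_int.mp hp
  have not_dvd {z : ℤ} (hz : z ≠ 0) (hzp : z.natAbs < p) : ¬ (p : ℤ) ∣ z := fun h ↦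
    absurd (Nat.le_of_dvd (Int.natAbs_pos.mpr hz) (Int.natCast_dvd.mp h)) (by omega)
  set k := p * f.natDegree
  obtain ⟨z, hz⟩ : ∃ z : ℤ, (z : K) = (L : K) ^ k * ∑ β ∈ s, b β * aeval β g := by
    refine exists_int_cast_eq_of_isIntegral_of_fixed ?_ fun σ ↦ ?_
    · rw [Finset.mul_sum]
      refine IsIntegral.sum _ fun β hβ ↦ ?_
      rw [mul_left_comm]
      exact (hb β hβ).mul (isIntegral_pow_mul_aeval (hL β hβ) (hg.trans (Nat.sub_le _ _)))
    · rw [map_mul, map_pow, map_intCast, map_sum]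
      congr 1
      refine Finset.sum_bij (fun β _ ↦ σ β) (fun β hβ ↦ hs σ β hβ)
        (fun _ _ _ _ h ↦ σ.injective h)
        (fun β hβ ↦ ⟨σ.symm β, hs σ.symm β hβ, σ.apply_symm_apply β⟩) fun β hβ ↦ ?_
      rw [map_mul, hbσ σ β hβ]
      congr 1
      exact (aeval_algHom_apply (σ.toAlgHom.restrictScalars ℤ) β g).symm
  have hφz : (z : ℂ) = (L : ℂ) ^ k * ∑ β ∈ s, φ (b β) * aeval (φ β) g := by
    have := congrArg φ hz
    simp only [map_intCast, map_mul, map_pow, map_sum] at this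
    rw [this]
    congr 1
    refine Finset.sum_congr rfl fun β _ ↦ ?_
    congr 1
    exact (aeval_algHom_apply φ.toIntAlgHom β g).symm
  have hne : L ^ k * n * m + p * z ≠ 0 := by
    intro h
    have hdvd : (p : ℤ) ∣ L ^ k * n * m := ⟨-z, by linear_combination h⟩
    rcases hpI.dvd_or_dvd hdvd with h | h
    · rcases hpI.dvd_or_dvd h with h | h
      · exact not_dvd hL0 (by omega) (hpI.dvd_of_dvd_pow h)
      · exact hpn h
    · exact not_dvd hm (by omega) h
  have heq : ((L ^ k * n * m + p * z : ℤ) : ℂ) =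
      -((L : ℂ) ^ k * ∑ β ∈ s, φ (b β) * (n • exp (φ β) - p • aeval (φ β) g)) := by
    have hsum : ∑ β ∈ s, φ (b β) * (n • exp (φ β) - p • aeval (φ β) g) =
        n * ∑ β ∈ s, φ (b β) * exp (φ β) - p * ∑ β ∈ s, φ (b β) * aeval (φ β) g := by
      rw [Finset.mul_sum, Finset.mul_sum, ← Finset.sum_sub_distrib]
      refine Finset.sum_congr rfl fun β _ ↦ ?_
      rw [zsmul_eq_mul, nsmul_eq_mul]
      ring
    rw [hsum]
    push_cast
    rw [hφz]
    linear_combination (L : ℂ) ^ k * n * h0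
  have hle : ‖((L ^ k * n * m + p * z : ℤ) : ℂ)‖ ≤
      |(L : ℝ)| ^ k * ((∑ β ∈ s, ‖φ (b β)‖) * (c ^ p / (p - 1).factorial)) := by
    rw [heq, norm_neg, norm_mul, norm_pow, norm_intCast, Finset.sum_mul]
    gcongr
    refine norm_sum_le_of_le _ fun β hβ ↦ ?_
    rw [norm_mul]
    gcongr
    refine happ ((mem_aroots).mpr ⟨hfne, ?_⟩)
    rw [show aeval (φ β) f = φ (aeval β f) from aeval_algHom_apply φ.toIntAlgHom β f, hf β hβ,
      map_zero]
  have hone : (1 : ℝ) ≤ ‖((L ^ k * n * m + p * z : ℤ) : ℂ)‖ := by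
    rw [norm_intCast]
    exact_mod_cast Int.one_le_abs hne
  linarith

section ExponentialPolynomials

open AddMonoidAlgebra

/-- Evaluation of a formal exponential sum `∑ b_β [β]` at the complex exponential, along an
embedding `φ` of the field into `ℂ`. -/
noncomputable def AddMonoidAlgebra.expEval {K : Type*} [Field K] (φ : K →+* ℂ) :
    AddMonoidAlgebra K K →+* ℂ :=
  liftNCRingHom φ (Complex.expMonoidHom.comp (AddMonoidHom.toMultiplicative φ.toAddMonoidHom))
    fun _ _ ↦ Commute.all _ _

@[simp]
theorem AddMonoidAlgebra.expEval_single {K : Type*} [Field K] (φ : K →+* ℂ) (β b : K) :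
    expEval φ (single β b) = φ b * Complex.exp (φ β) := by
  simp [expEval]

theorem AddMonoidAlgebra.expEval_eq_sum {K : Type*} [Field K] (φ : K →+* ℂ)
    (F : AddMonoidAlgebra K K) :
    expEval φ F = ∑ β ∈ F.coeff.support, φ (F.coeff β) * Complex.exp (φ β) :=
  rfl

/-- The Galois group acts on formal exponential sums through both coefficients and exponents. -/
noncomputable def AddMonoidAlgebra.galConj {K : Type*} [Field K] [CharZero K] (σ : Gal(K/ℚ)) :
    AddMonoidAlgebra K K ≃+* AddMonoidAlgebra K K :=
  (mapDomainRingEquiv K (σ : K ≃+ K)).trans (mapRingEquiv K (σ : K ≃+* K))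

theorem AddMonoidAlgebra.coeff_galConj {K : Type*} [Field K] [CharZero K] (σ : Gal(K/ℚ))
    (F : AddMonoidAlgebra K K) (β : K) :
    (galConj σ F).coeff (σ β) = σ (F.coeff β) := by
  simp [galConj]

theorem AddMonoidAlgebra.galConj_mul {K : Type*} [Field K] [CharZero K] (σ τ : Gal(K/ℚ))
    (F : AddMonoidAlgebra K K) :
    galConj (σ * τ) F = galConj σ (galConj τ F) := by
  ext β
  obtain ⟨β, rfl⟩ := (σ * τ).surjective β
  rw [coeff_galConj]
  simp [AlgEquiv.mul_apply, coeff_galConj]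

@[simp]
theorem AddMonoidAlgebra.galConj_one {K : Type*} [Field K] [CharZero K]
    (F : AddMonoidAlgebra K K) :
    galConj (1 : Gal(K/ℚ)) F = F := by
  ext β
  exact coeff_galConj 1 F β

@[simp]
theorem AddMonoidAlgebra.galConj_single {K : Type*} [Field K] [CharZero K] (σ : Gal(K/ℚ))
    (β b : K) : galConj σ (single β b) = single (σ β) (σ b) := by
  simp [galConj]
  rfl


theorem AddMonoidAlgebra.expEval_ne_zero_of_galConj_eq {K : Type*} [Field K] [NumberField K]
    [IsGalois ℚ K] (φ : K →+* ℂ) (F : AddMonoidAlgebra K K)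
    (hF : ∀ σ : Gal(K/ℚ), galConj σ F = F) (h0 : F.coeff 0 ≠ 0) : expEval φ F ≠ 0 := by
  classical
  have hc (σ : Gal(K/ℚ)) (β : K) : F.coeff (σ β) = σ (F.coeff β) := by
    rw [← coeff_galConj, hF]
  have : Algebra.IsAlgebraic ℤ K :=
    (IsFractionRing.comap_isAlgebraic_iff (A := ℤ) (K := ℚ)).mpr inferInstance
  obtain ⟨D, hD0, hD⟩ :=
    Algebra.IsAlgebraic.exists_integral_multiples ℤ (F.coeff.support.image F.coeff)
  have hD' (β : K) (hβ : β ∈ F.coeff.support) : IsIntegral ℤ (D • F.coeff β) :=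
    hD _ (Finset.mem_image_of_mem _ hβ)
  have h0s : (0 : K) ∈ F.coeff.support := Finsupp.mem_support_iff.mpr h0
  obtain ⟨m, hm⟩ := exists_int_cast_eq_of_isIntegral_of_fixed (hD' 0 h0s) fun σ ↦ by
    rw [map_zsmul, ← hc, map_zero]
  have hm0 : m ≠ 0 := by
    rintro rfl
    simp [hD0, h0] at hm
  have key := add_sum_mul_exp_ne_zero_of_isIntegral φ (F.coeff.support.erase 0)
    (fun β hβ ↦ Finset.ne_of_mem_erase hβ)
    (fun σ β hβ ↦ by simpa [hc] using hβ) (fun β ↦ D • F.coeff β)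
    (fun β hβ ↦ hD' β (Finset.mem_of_mem_erase hβ)) (fun σ β _ ↦ by simp [hc]) m hm0
  refine fun hE ↦ key ?_
  rw [expEval_eq_sum, ← Finset.add_sum_erase _ _ h0s] at hE
  have hm' : (m : ℂ) = D * φ (F.coeff 0) := by
    rw [← map_intCast φ, hm]
    simp
  rw [map_zero φ, Complex.exp_zero, mul_one] at hE
  simp only [zsmul_eq_mul, map_mul, map_intCast, mul_assoc]
  rw [hm', ← Finset.mul_sum, ← mul_add, hE, mul_zero]

theorem AddMonoidAlgebra.expEval_ne_zero {K : Type*} [Field K] [NumberField K]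
    [IsGalois ℚ K] (φ : K →+* ℂ) {F : AddMonoidAlgebra K K} (hF : F ≠ 0) :
    expEval φ F ≠ 0 := by
  intro hE
  set P := ∏ σ : Gal(K/ℚ), galConj σ F
  have hP0 : P ≠ 0 := Finset.prod_ne_zero_iff.mpr fun σ _ ↦ by simpa using hF
  have hPE : expEval φ P = 0 := by
    rw [map_prod]
    exact Finset.prod_eq_zero (Finset.mem_univ 1) (by rwa [galConj_one])
  have hPσ (τ : Gal(K/ℚ)) : galConj τ P = P := by
    rw [map_prod]
    exact Fintype.prod_equiv (Equiv.mulLeft τ) _ _ fun σ ↦ (galConj_mul τ σ F).symm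
  obtain ⟨β, hβ⟩ : ∃ β, P.coeff β ≠ 0 := by
    by_contra! h
    exact hP0 (by ext β; simpa using h β)
  set Q := ∑ σ : Gal(K/ℚ), galConj σ (single (-β) (P.coeff β)⁻¹) with hQ
  have hQσ (τ : Gal(K/ℚ)) : galConj τ Q = Q := by
    rw [map_sum]
    exact Fintype.sum_equiv (Equiv.mulLeft τ) _ _ fun σ ↦ (galConj_mul τ σ _).symm
  refine expEval_ne_zero_of_galConj_eq φ (P * Q) (fun σ ↦ by rw [map_mul, hPσ, hQσ]) ?_
    (by rw [map_mul, hPE, zero_mul])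
  have hterm (σ : Gal(K/ℚ)) :
      (P * galConj σ (single (-β) (P.coeff β)⁻¹)).coeff 0 = 1 := by
    have hβσ : P.coeff (σ β) = σ (P.coeff β) := by rw [← coeff_galConj, hPσ]
    rw [galConj_single, coeff_mul_single_eq_coeff_mul (σ β), hβσ, ← map_mul, mul_inv_cancel₀ hβ,
      map_one]
    intro a _
    simp [add_neg_eq_zero]
  rw [hQ, Finset.mul_sum, coeff_sum, Finsupp.finsetSum_apply,
    Finset.sum_congr rfl fun σ _ ↦ hterm σ]
  simp

end ExponentialPolynomials

theorem exists_isGalois_numberField_mem (s : Finset ℂ) (hs : ∀ z ∈ s, IsAlgebraic ℚ z) :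
    ∃ K : IntermediateField ℚ ℂ, NumberField K ∧ IsGalois ℚ K ∧ ∀ z ∈ s, z ∈ K := by
  set p := ∏ z ∈ s, minpoly ℚ z
  have hp0 : p ≠ 0 := Finset.prod_ne_zero_iff.mpr fun z hz ↦ minpoly.ne_zero (hs z hz).isIntegral
  have hK := IntermediateField.adjoin_rootSet_isSplittingField (K := ℚ) (L := ℂ) (p := p)
    (IsAlgClosed.splits _)
  have hfin := @Polynomial.IsSplittingField.finiteDimensional _ _ _ _ _ p hK
  have hnorm := Normal.of_isSplittingField (hFEp := hK)
  refine ⟨IntermediateField.adjoin ℚ (p.rootSet ℂ), { to_finiteDimensional := hfin }, ?_,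
    fun z hz ↦ IntermediateField.subset_adjoin _ _ ?_⟩
  · convert @IsGalois.mk ℚ _ _ _ _ inferInstance hnorm
    exact Subsingleton.elim _ _
  rw [Polynomial.mem_rootSet]
  refine ⟨hp0, ?_⟩
  rw [map_prod]
  exact Finset.prod_eq_zero hz (minpoly.aeval ℚ z)

/-- The **Lindemann–Weierstrass theorem**: exponentials of distinct algebraic numbers are linearly
independent over the algebraic numbers. -/
theorem sum_mul_exp_ne_zero_of_isAlgebraic {s : Finset ℂ} (hs : s.Nonempty) {b : ℂ → ℂ}
    (halg : ∀ β ∈ s, IsAlgebraic ℚ β) (hb : ∀ β ∈ s, IsAlgebraic ℚ (b β))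
    (hb0 : ∀ β ∈ s, b β ≠ 0) : ∑ β ∈ s, b β * Complex.exp β ≠ 0 := by
  classical
  obtain ⟨K, hK, hGal, hmem⟩ := exists_isGalois_numberField_mem (s ∪ s.image b) (by
    simp only [Finset.mem_union, Finset.mem_image]
    rintro _ (hz | ⟨β, hβ, rfl⟩)
    exacts [halg _ hz, hb β hβ])
  have hsK (β : s) : (β : ℂ) ∈ K := hmem _ (Finset.mem_union_left _ β.2)
  have hbK (β : s) : b β ∈ K := hmem _ (Finset.mem_union_right _ (Finset.mem_image_of_mem _ β.2))
  have hne : ∑ β : s, AddMonoidAlgebra.single (⟨β, hsK β⟩ : K) (⟨b β, hbK β⟩ : K) ≠ 0 := by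
    obtain ⟨β, hβ⟩ := hs
    intro h
    have := congrArg (fun F : AddMonoidAlgebra K K ↦ F.coeff ⟨β, hsK ⟨β, hβ⟩⟩) h
    simp only [AddMonoidAlgebra.coeff_sum, Finsupp.finsetSum_apply,
      AddMonoidAlgebra.coeff_single] at this
    rw [Finset.sum_eq_single ⟨β, hβ⟩] at this
    · exact hb0 β hβ (by simpa using congrArg (algebraMap K ℂ) this)
    · intro γ _ hγ
      refine Finsupp.single_eq_of_ne' fun h ↦ hγ (Subtype.ext ?_)
      simpa using h
    · simp
  have := AddMonoidAlgebra.expEval_ne_zero (algebraMap K ℂ) hne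
  rw [← Finset.sum_coe_sort]
  simpa using this

/-- If `0 < a < 1` is algebraic, `x ≠ 0` is algebraic, and `sinh(a·w)·e^w = x`,
then `w` is transcendental over `ℚ`. -/
theorem stmt_0 (a x w : ℝ) (ha0 : 0 < a) (ha1 : a < 1)
    (haAlg : IsAlgebraic ℚ a) (hxAlg : IsAlgebraic ℚ x) (hx : x ≠ 0)
    (hw : Real.sinh (a * w) * Real.exp w = x) :
    Transcendental ℚ w := by
  intro hwAlg
  have hw0 : w ≠ 0 := by
    rintro rfl
    simp [hx.symm] at hw
  have hexp : Real.exp ((1 + a) * w) - Real.exp ((1 - a) * w) - 2 * x = 0 := by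
    rw [← hw, Real.sinh_eq, show (1 + a) * w = a * w + w by ring,
      show (1 - a) * w = -(a * w) + w by ring, Real.exp_add, Real.exp_add]
    ring
  have toC {r : ℝ} (hr : IsAlgebraic ℚ r) : IsAlgebraic ℚ (r : ℂ) := hr.algebraMap
  have h1 : IsAlgebraic ℚ (((1 + a) * w : ℝ) : ℂ) := toC ((isAlgebraic_one.add haAlg).mul hwAlg)
  have h2 : IsAlgebraic ℚ (((1 - a) * w : ℝ) : ℂ) := toC ((isAlgebraic_one.sub haAlg).mul hwAlg)
  have n12 : (((1 + a) * w : ℝ) : ℂ) ≠ (((1 - a) * w : ℝ) : ℂ) := by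
    rw [Complex.ofReal_injective.ne_iff, (mul_left_injective₀ hw0).ne_iff]
    linarith
  have n1 : (((1 + a) * w : ℝ) : ℂ) ≠ 0 :=
    Complex.ofReal_ne_zero.mpr (mul_ne_zero (by linarith) hw0)
  have n2 : (((1 - a) * w : ℝ) : ℂ) ≠ 0 :=
    Complex.ofReal_ne_zero.mpr (mul_ne_zero (by linarith) hw0)
  have hexpC : Complex.exp ((1 + a) * w : ℝ) - Complex.exp ((1 - a) * w : ℝ) - 2 * x = 0 := by
    exact_mod_cast congrArg Complex.ofReal hexp
  generalize (((1 + a) * w : ℝ) : ℂ) = u at *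
  generalize (((1 - a) * w : ℝ) : ℂ) = v at *
  have hxC : (x : ℂ) ≠ 0 := Complex.ofReal_ne_zero.mpr hx
  refine sum_mul_exp_ne_zero_of_isAlgebraic (s := {u, v, 0}) (by simp)
    (b := fun z ↦ if z = u then 1 else if z = v then -1 else -(2 * x)) ?_ ?_ ?_ ?_
  · simp [h1, h2, isAlgebraic_zero]
  · intro z _
    split_ifs
    · exact isAlgebraic_one
    · exact isAlgebraic_one.neg
    · exact ((isAlgebraic_natCast (n := 2)).mul (toC hxAlg)).neg
  · intro z _
    split_ifs <;> simp [hxC]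
  · rw [Finset.sum_insert (by simp [n12, n1]), Finset.sum_insert (by simp [n2]),
      Finset.sum_singleton]
    simp only [n12.symm, n1.symm, n2.symm, ↓reduceIte, Complex.exp_zero]
    linear_combination hexpC
end

section
/- For 0 < a < 1, the transition function z ↦ ω(a,z) is (improperly) integrable on (−∞, 0) and ∫_{−∞}^{0} ω(a,z) dz = π² / (3·(a² − 1)). -/
/-- `f(a,w) = sinh(a·w)·e^w`. -/
noncomputable def fab (a w : ℝ) : ℝ := Real.sinh (a * w) * Real.exp w

/-- `M_a = (1/(2a))·log((1−a)/(1+a))`. -/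
noncomputable def Ma (a : ℝ) : ℝ := (1 / (2 * a)) * Real.log ((1 - a) / (1 + a))

/-- `L_a = −(a/√(1−a²))·((1−a)/(1+a))^{1/(2a)}`, the minimum value of `f(a,·)`. -/
noncomputable def La (a : ℝ) : ℝ :=
  -(a / Real.sqrt (1 - a ^ 2)) * ((1 - a) / (1 + a)) ^ (1 / (2 * a))

open MeasureTheory Set

lemma fab_eq_exp (a w : ℝ) :
    fab a w = (Real.exp ((1 + a) * w) - Real.exp ((1 - a) * w)) / 2 := by
  rw [fab, Real.sinh_eq, div_mul_eq_mul_div, sub_mul, ← Real.exp_add, ← Real.exp_add]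
  ring_nf

lemma continuous_fab (a : ℝ) : Continuous (fab a) := by
  unfold fab
  fun_prop

lemma hasDerivAt_fab (a w : ℝ) :
    HasDerivAt (fab a)
      (((1 + a) * Real.exp ((1 + a) * w) - (1 - a) * Real.exp ((1 - a) * w)) / 2) w := by
  have h : ∀ c : ℝ, HasDerivAt (fun w => Real.exp (c * w)) (c * Real.exp (c * w)) w := fun c => by
    simpa [mul_comm] using ((hasDerivAt_id w).const_mul c).exp
  rw [show fab a = fun w => _ from funext (fab_eq_exp a)]
  exact ((h (1 + a)).sub (h (1 - a))).div_const 2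

section Branches

variable {a : ℝ} (ha0 : 0 < a) (ha1 : a < 1)
include ha0 ha1

omit ha1 in
lemma two_mul_Ma : 2 * a * Ma a = Real.log ((1 - a) / (1 + a)) := by
  unfold Ma
  field_simp

lemma exp_two_mul_Ma : Real.exp (2 * a * Ma a) = (1 - a) / (1 + a) := by
  rw [two_mul_Ma ha0, Real.exp_log (div_pos (by linarith) (by linarith))]

lemma Ma_neg : Ma a < 0 := by
  have h : Real.log ((1 - a) / (1 + a)) < 0 :=
    Real.log_neg (div_pos (by linarith) (by linarith))
      ((div_lt_one (by linarith)).2 (by linarith))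
  rw [← two_mul_Ma ha0] at h
  exact neg_of_mul_neg_right h (by positivity)

lemma exp_mul_eq_exp_Ma (w : ℝ) :
    (1 + a) * Real.exp ((1 + a) * w) =
      (1 - a) * Real.exp ((1 - a) * w) * Real.exp (2 * a * (w - Ma a)) := by
  have h := exp_two_mul_Ma ha0 ha1
  have e : Real.exp ((1 + a) * w) =
      Real.exp ((1 - a) * w) * (Real.exp (2 * a * (w - Ma a)) * Real.exp (2 * a * Ma a)) := by
    rw [← Real.exp_add, ← Real.exp_add]
    ring_nf
  have : 1 + a ≠ 0 := by positivity
  rw [e, h]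
  field_simp

lemma fab_strictMonoOn : StrictMonoOn (fab a) (Ici (Ma a)) := by
  refine strictMonoOn_of_deriv_pos (convex_Ici _) (continuous_fab a).continuousOn fun w hw => ?_
  rw [interior_Ici, mem_Ioi] at hw
  have h1 : 1 < Real.exp (2 * a * (w - Ma a)) :=
    Real.one_lt_exp_iff.2 (mul_pos (by positivity) (by linarith))
  have h2 : 0 < (1 - a) * Real.exp ((1 - a) * w) := mul_pos (by linarith) (Real.exp_pos _)
  rw [(hasDerivAt_fab a w).deriv, exp_mul_eq_exp_Ma ha0 ha1]
  nlinarith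

lemma fab_strictAntiOn : StrictAntiOn (fab a) (Iic (Ma a)) := by
  refine strictAntiOn_of_deriv_neg (convex_Iic _) (continuous_fab a).continuousOn fun w hw => ?_
  rw [interior_Iic, mem_Iio] at hw
  have h1 : Real.exp (2 * a * (w - Ma a)) < 1 :=
    Real.exp_lt_one_iff.2 (mul_neg_of_pos_of_neg (by positivity) (by linarith))
  have h2 : 0 < (1 - a) * Real.exp ((1 - a) * w) := mul_pos (by linarith) (Real.exp_pos _)
  rw [(hasDerivAt_fab a w).deriv, exp_mul_eq_exp_Ma ha0 ha1]
  nlinarith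

lemma fab_Ma : fab a (Ma a) = La a := by
  have hq : 0 < (1 - a) / (1 + a) := div_pos (by linarith) (by linarith)
  have hs : Real.exp (a * Ma a) ^ 2 = (1 - a) / (1 + a) := by
    rw [← exp_two_mul_Ma ha0 ha1, ← Real.exp_nat_mul]
    push_cast
    ring_nf
  have hs0 := Real.exp_pos (a * Ma a)
  have hsqrt : Real.sqrt (1 - a ^ 2) = (1 + a) * Real.exp (a * Ma a) := by
    rw [Real.sqrt_eq_iff_mul_self_eq (by nlinarith) (by positivity)]
    have : (1 + a) * Real.exp (a * Ma a) * ((1 + a) * Real.exp (a * Ma a)) =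
        (1 + a) ^ 2 * Real.exp (a * Ma a) ^ 2 := by ring
    rw [this, hs]
    field_simp
    ring
  have hM : Real.exp (Ma a) = ((1 - a) / (1 + a)) ^ (1 / (2 * a)) := by
    rw [Real.rpow_def_of_pos hq, Ma, mul_comm]
  rw [fab, La, hM, hsqrt, Real.sinh_eq, Real.exp_neg]
  congr 1
  have h1 : 1 + a ≠ 0 := by positivity
  rw [eq_div_iff h1] at hs
  field_simp
  linarith

lemma La_le_fab (w : ℝ) : La a ≤ fab a w := by
  rw [← fab_Ma ha0 ha1]
  rcases le_total w (Ma a) with h | h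
  · exact (fab_strictAntiOn ha0 ha1).antitoneOn h self_mem_Iic h
  · exact (fab_strictMonoOn ha0 ha1).monotoneOn self_mem_Ici h h

omit ha1 in
lemma fab_neg_iff {w : ℝ} : fab a w < 0 ↔ w < 0 := by
  rw [fab, ← not_le, ← not_le, mul_nonneg_iff_of_pos_right (Real.exp_pos w), Real.sinh_nonneg_iff,
    mul_nonneg_iff_of_pos_left ha0]

/-- A point `y` on the other side of `M_a` with the same value of `f(a,·)` as `z` bounds from
below exactly the `w > z` with a larger value. -/
lemma lt_iff_fab_lt_of_lt {z y w : ℝ} (hl : z < Ma a → Ma a ≤ y) (hr : Ma a ≤ z → y ≤ Ma a)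
    (hy : fab a y = fab a z) (hzw : z < w) : y < w ↔ fab a z < fab a w := by
  have hmono := fab_strictMonoOn ha0 ha1
  have hanti := fab_strictAntiOn ha0 ha1
  rcases lt_or_ge z (Ma a) with hz | hz
  · have hyM := hl hz
    rw [← hy]
    rcases le_or_gt w (Ma a) with hw | hw
    · have h1 := hanti (mem_Iic.2 hz.le) (mem_Iic.2 hw) hzw
      constructor <;> intro <;> linarith
    · exact (hmono.lt_iff_lt (mem_Ici.2 hyM) (mem_Ici.2 hw.le)).symm
  · exact iff_of_true ((hr hz).trans_lt (hz.trans_lt hzw))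
      (hmono (mem_Ici.2 hz) (mem_Ici.2 (hz.trans hzw.le)) hzw)

/-- A point `y` on the other side of `M_a` with the same value of `f(a,·)` as `z` bounds from
below exactly the `w < z` with a smaller value. -/
lemma lt_iff_fab_lt_of_gt {z y w : ℝ} (hl : z < Ma a → Ma a ≤ y) (hr : Ma a ≤ z → y ≤ Ma a)
    (hy : fab a y = fab a z) (hwz : w < z) : y < w ↔ fab a w < fab a z := by
  have hmono := fab_strictMonoOn ha0 ha1
  have hanti := fab_strictAntiOn ha0 ha1
  rcases lt_or_ge z (Ma a) with hz | hz
  · have h1 := hanti (mem_Iic.2 (hwz.le.trans hz.le)) (mem_Iic.2 hz.le) hwz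
    have h2 := hl hz
    constructor <;> intro <;> linarith
  · have hyM := hr hz
    rcases le_or_gt w (Ma a) with hw | hw
    · rw [← hy]
      exact (hanti.lt_iff_gt (mem_Iic.2 hw) (mem_Iic.2 hyM)).symm
    · exact iff_of_true (by linarith) (hmono (mem_Ici.2 hw.le) (mem_Ici.2 hz) hwz)

end Branches

/-- The pairs `z < w < 0` with `f(a,z) < f(a,w)`. -/
def incrRegion (a : ℝ) : Set (ℝ × ℝ) := {p | p.1 < p.2 ∧ p.2 < 0 ∧ fab a p.1 < fab a p.2}

lemma measurableSet_incrRegion (a : ℝ) : MeasurableSet (incrRegion a) := by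
  have h := continuous_fab a
  exact ((isOpen_lt continuous_fst continuous_snd).inter
    ((isOpen_lt continuous_snd continuous_const).inter
      (isOpen_lt (h.comp continuous_fst) (h.comp continuous_snd)))).measurableSet

/-- Both orientations of `incrRegion`. -/
def incrRegionSymm (a : ℝ) : Set (ℝ × ℝ) := incrRegion a ∪ Prod.swap ⁻¹' incrRegion a

lemma measurableSet_incrRegionSymm (a : ℝ) : MeasurableSet (incrRegionSymm a) :=
  (measurableSet_incrRegion a).union (measurable_swap (measurableSet_incrRegion a))

lemma volume_incrRegionSymm (a : ℝ) :
    volume (incrRegionSymm a) = 2 * volume (incrRegion a) := by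
  have hdisj : Disjoint (incrRegion a) (Prod.swap ⁻¹' incrRegion a) := by
    rw [Set.disjoint_left]
    rintro ⟨z, w⟩ h1 h2
    exact lt_asymm h1.1 h2.1
  have hswap : volume (Prod.swap ⁻¹' incrRegion a) = volume (incrRegion a) :=
    (Measure.measurePreserving_swap (μ := volume) (ν := volume)).measure_preimage
      (measurableSet_incrRegion a).nullMeasurableSet
  rw [incrRegionSymm, measure_union hdisj (measurable_swap (measurableSet_incrRegion a)), hswap,
    two_mul]

lemma volume_incrRegionSymm_slice {a : ℝ} (ha0 : 0 < a) (ha1 : a < 1) {z y : ℝ} (hz : z < 0)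
    (hl : z < Ma a → Ma a ≤ y) (hr : Ma a ≤ z → y ≤ Ma a) (hy : fab a y = fab a z) :
    volume (Prod.mk z ⁻¹' incrRegionSymm a) = ENNReal.ofReal (-y) := by
  rw [show -y = 0 - y by ring, ← Real.volume_Ioo]
  refine measure_congr ?_
  have hne : ∀ᵐ w : ℝ, w ≠ z := by simp [ae_iff]
  filter_upwards [hne] with w hw
  refine propext ?_
  change (z < w ∧ w < 0 ∧ fab a z < fab a w) ∨ (w < z ∧ z < 0 ∧ fab a w < fab a z) ↔
    y < w ∧ w < 0
  rcases lt_or_gt_of_ne hw with h | h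
  · rw [lt_iff_fab_lt_of_gt ha0 ha1 hl hr hy h]
    have := h.trans hz
    have := h.not_gt
    tauto
  · rw [lt_iff_fab_lt_of_lt ha0 ha1 hl hr hy h]
    have := h.not_gt
    tauto

lemma incrRegionSymm_slice_eq_empty {a z : ℝ} (hz : 0 ≤ z) :
    Prod.mk z ⁻¹' incrRegionSymm a = ∅ := by
  ext w
  simp only [mem_preimage, incrRegionSymm, incrRegion, mem_union, mem_ofPred_eq, Prod.swap_prod_mk,
    mem_empty_iff_false, iff_false, not_or, not_and]
  constructor <;> intros <;> linarith

lemma lintegral_neg_log_one_sub_exp {c : ℝ} (hc : 0 < c) :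
    ∫⁻ t in Ioi (0 : ℝ), ENNReal.ofReal (-Real.log (1 - Real.exp (-(c * t)))) =
      ENNReal.ofReal (Real.pi ^ 2 / (6 * c)) := by
  have hterm : ∀ n : ℕ, ∫⁻ t in Ioi (0 : ℝ),
      ENNReal.ofReal (Real.exp (-(c * t)) ^ (n + 1) / (n + 1)) =
        ENNReal.ofReal (1 / c * (1 / ((n + 1 : ℕ) : ℝ) ^ 2)) := fun n => by
    have hn : -(c * (n + 1)) < 0 := by
      have : 0 < c * ((n : ℝ) + 1) := by positivity
      linarith
    have he : ∀ t : ℝ, Real.exp (-(c * t)) ^ (n + 1) / (n + 1) =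
        Real.exp (-(c * (n + 1)) * t) / (n + 1) := fun t => by
      rw [← Real.exp_nat_mul]
      push_cast
      ring_nf
    simp_rw [he]
    rw [← ofReal_integral_eq_lintegral_ofReal
      ((integrableOn_exp_mul_Ioi hn 0).div_const _)
      (Filter.Eventually.of_forall fun t => by positivity), integral_div,
      integral_exp_mul_Ioi hn]
    congr 1
    push_cast
    simp
    field_simp
  have hsum : HasSum (fun n : ℕ => 1 / c * (1 / ((n + 1 : ℕ) : ℝ) ^ 2))
      (Real.pi ^ 2 / (6 * c)) := by
    have h := (hasSum_nat_add_iff' 1).2 hasSum_zeta_two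
    have e : Real.pi ^ 2 / (6 * c) =
        1 / c * (Real.pi ^ 2 / 6 - ∑ i ∈ Finset.range 1, 1 / (i : ℝ) ^ 2) := by
      simp
      field_simp
    rw [e]
    exact h.mul_left (1 / c)
  calc
    _ = ∫⁻ t in Ioi (0 : ℝ),
        ∑' n : ℕ, ENNReal.ofReal (Real.exp (-(c * t)) ^ (n + 1) / (n + 1)) := by
      refine setLIntegral_congr_fun measurableSet_Ioi fun t ht => ?_
      have hlt : Real.exp (-(c * t)) < 1 :=
        Real.exp_lt_one_iff.2 (neg_lt_zero.2 (mul_pos hc ht))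
      have hs := Real.hasSum_pow_div_log_of_abs_lt_one
        (x := Real.exp (-(c * t))) (by rwa [abs_of_pos (Real.exp_pos _)])
      rw [← hs.tsum_eq, ENNReal.ofReal_tsum_of_nonneg (fun n => by positivity) hs.summable]
    _ = ∑' n : ℕ, ENNReal.ofReal (1 / c * (1 / ((n + 1 : ℕ) : ℝ) ^ 2)) := by
      rw [lintegral_tsum fun n => by fun_prop]
      exact tsum_congr hterm
    _ = _ := by
      rw [← ENNReal.ofReal_tsum_of_nonneg (fun n => by positivity) hsum.summable, hsum.tsum_eq]

lemma one_sub_exp_pos {x : ℝ} (hx : 0 < x) : 0 < 1 - Real.exp (-x) :=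
  sub_pos.2 (Real.exp_lt_one_iff.2 (neg_lt_zero.2 hx))

lemma neg_log_one_sub_exp_nonneg {x : ℝ} (hx : 0 < x) :
    0 ≤ -Real.log (1 - Real.exp (-x)) :=
  neg_nonneg.2 (Real.log_nonpos (one_sub_exp_pos hx).le (by linarith [Real.exp_pos (-x)]))

lemma ae_neg_log_one_sub_exp_nonneg {c : ℝ} (hc : 0 < c) :
    0 ≤ᵐ[volume.restrict (Ioi 0)] fun t : ℝ => -Real.log (1 - Real.exp (-(c * t))) := by
  filter_upwards [ae_restrict_mem measurableSet_Ioi] with t ht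
  exact neg_log_one_sub_exp_nonneg (mul_pos hc ht)

lemma integrableOn_neg_log_one_sub_exp {c : ℝ} (hc : 0 < c) :
    IntegrableOn (fun t : ℝ => -Real.log (1 - Real.exp (-(c * t)))) (Ioi 0) := by
  refine ⟨(by fun_prop : Measurable _).aestronglyMeasurable, ?_⟩
  rw [hasFiniteIntegral_iff_ofReal (ae_neg_log_one_sub_exp_nonneg hc),
    lintegral_neg_log_one_sub_exp hc]
  exact ENNReal.ofReal_lt_top

lemma integral_neg_log_one_sub_exp {c : ℝ} (hc : 0 < c) :
    ∫ t in Ioi (0 : ℝ), -Real.log (1 - Real.exp (-(c * t))) = Real.pi ^ 2 / (6 * c) := by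
  rw [integral_eq_lintegral_of_nonneg_ae (ae_neg_log_one_sub_exp_nonneg hc)
    (integrableOn_neg_log_one_sub_exp hc).aestronglyMeasurable, lintegral_neg_log_one_sub_exp hc,
    ENNReal.toReal_ofReal (by positivity)]

/-- The length of the section `w - z = t` of `incrRegion a`. -/
noncomputable def sectionLength (a t : ℝ) : ℝ :=
  (1 / (2 * a)) * (-Real.log (1 - Real.exp (-((1 - a) * t))) -
    -Real.log (1 - Real.exp (-((1 + a) * t))))

lemma fab_sub_lt_iff {a t w : ℝ} (ha0 : 0 < a) (ha1 : a < 1) (ht : 0 < t) :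
    fab a (w - t) < fab a w ↔ -sectionLength a t < w := by
  have hp := one_sub_exp_pos (mul_pos (by linarith : 0 < 1 + a) ht)
  have hm := one_sub_exp_pos (mul_pos (by linarith : 0 < 1 - a) ht)
  have e : ∀ c : ℝ, Real.exp (c * (w - t)) = Real.exp (c * w) * Real.exp (-(c * t)) := fun c => by
    rw [← Real.exp_add]
    ring_nf
  have h2 : Real.exp ((1 + a) * w) = Real.exp ((1 - a) * w) * Real.exp (2 * a * w) := by
    rw [← Real.exp_add]
    ring_nf
  have h0 := Real.exp_pos ((1 - a) * w)
  calc
    _ ↔ Real.exp ((1 - a) * w) * (1 - Real.exp (-((1 - a) * t))) <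
        Real.exp ((1 - a) * w) * (Real.exp (2 * a * w) * (1 - Real.exp (-((1 + a) * t)))) := by
      rw [fab_eq_exp, fab_eq_exp, e, e, h2]
      constructor <;> intro h <;> linarith
    _ ↔ Real.log (1 - Real.exp (-((1 - a) * t))) <
        2 * a * w + Real.log (1 - Real.exp (-((1 + a) * t))) := by
      rw [mul_lt_mul_iff_right₀ h0, ← Real.log_lt_log_iff hm (by positivity),
        Real.log_mul (Real.exp_pos _).ne' hp.ne', Real.log_exp]
    _ ↔ _ := by
      rw [sectionLength, ← mul_lt_mul_iff_right₀ (b := -_) (by positivity : 0 < 2 * a)]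
      have : 2 * a * -(1 / (2 * a) * (-Real.log (1 - Real.exp (-((1 - a) * t))) -
          -Real.log (1 - Real.exp (-((1 + a) * t))))) =
          Real.log (1 - Real.exp (-((1 - a) * t))) - Real.log (1 - Real.exp (-((1 + a) * t))) := by
        field_simp
        ring
      rw [this, sub_lt_iff_lt_add]

lemma sectionLength_nonneg {a t : ℝ} (ha0 : 0 < a) (ha1 : a < 1) (ht : 0 < t) :
    0 ≤ sectionLength a t := by
  have hm := one_sub_exp_pos (mul_pos (by linarith : 0 < 1 - a) ht)
  have h : Real.log (1 - Real.exp (-((1 - a) * t))) ≤ Real.log (1 - Real.exp (-((1 + a) * t))) := by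
    refine Real.log_le_log hm (sub_le_sub_left (Real.exp_le_exp.2 ?_) 1)
    nlinarith
  exact mul_nonneg (by positivity) (by linarith)

lemma lintegral_sectionLength {a : ℝ} (ha0 : 0 < a) (ha1 : a < 1) :
    ∫⁻ t in Ioi (0 : ℝ), ENNReal.ofReal (sectionLength a t) =
      ENNReal.ofReal (Real.pi ^ 2 / (6 * (1 - a ^ 2))) := by
  have hm : 0 < 1 - a := by linarith
  have hp : 0 < 1 + a := by linarith
  have im := integrableOn_neg_log_one_sub_exp hm
  have ip := integrableOn_neg_log_one_sub_exp hp
  rw [← ofReal_integral_eq_lintegral_ofReal]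
  · congr 1
    unfold sectionLength
    rw [integral_const_mul, integral_sub im ip, integral_neg_log_one_sub_exp hm,
      integral_neg_log_one_sub_exp hp, show 1 - a ^ 2 = (1 - a) * (1 + a) by ring]
    field_simp
    ring
  · exact (im.sub ip).const_mul _
  · filter_upwards [ae_restrict_mem measurableSet_Ioi] with t ht
    exact sectionLength_nonneg ha0 ha1 ht

lemma volume_incrRegion {a : ℝ} (ha0 : 0 < a) (ha1 : a < 1) :
    volume (incrRegion a) = ENNReal.ofReal (Real.pi ^ 2 / (6 * (1 - a ^ 2))) := by
  have hmeas := measurableSet_incrRegion a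
  have hind : Measurable ((incrRegion a).indicator (1 : ℝ × ℝ → ENNReal)) :=
    measurable_one.indicator hmeas
  have hslice : ∀ t : ℝ, ∫⁻ w, (incrRegion a).indicator (1 : ℝ × ℝ → ENNReal) (w - t, w) =
      (Ioi 0).indicator (fun t => ENNReal.ofReal (sectionLength a t)) t := fun t => by
    rcases lt_or_ge 0 t with ht | ht
    · have h : ∀ w, (incrRegion a).indicator (1 : ℝ × ℝ → ENNReal) (w - t, w) =
          (Ioo (-sectionLength a t) 0).indicator 1 w := fun w => by
        refine indicator_eq_indicator ?_ rfl
        change w - t < w ∧ w < 0 ∧ fab a (w - t) < fab a w ↔ -sectionLength a t < w ∧ w < 0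
        rw [fab_sub_lt_iff ha0 ha1 ht]
        have : w - t < w := by linarith
        tauto
      simp_rw [h]
      rw [indicator_of_mem (mem_Ioi.2 ht), lintegral_indicator_one measurableSet_Ioo,
        Real.volume_Ioo, zero_sub, neg_neg]
    · have h : ∀ w, (incrRegion a).indicator (1 : ℝ × ℝ → ENNReal) (w - t, w) = 0 := fun w =>
        indicator_of_notMem (fun hw => by linarith [show w - t < w from hw.1]) _
      simp_rw [h]
      rw [indicator_of_notMem (by simpa using ht), lintegral_zero]
  calc
    _ = ∫⁻ p, (incrRegion a).indicator (1 : ℝ × ℝ → ENNReal) p := by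
      rw [lintegral_indicator_one hmeas]
    _ = ∫⁻ w, ∫⁻ z, (incrRegion a).indicator (1 : ℝ × ℝ → ENNReal) (z, w) := by
      rw [Measure.volume_eq_prod, lintegral_prod_symm _ hind.aemeasurable]
    _ = ∫⁻ w, ∫⁻ t, (incrRegion a).indicator (1 : ℝ × ℝ → ENNReal) (w - t, w) := by
      refine lintegral_congr fun w => ?_
      exact (lintegral_sub_left_eq_self
        (fun z => (incrRegion a).indicator (1 : ℝ × ℝ → ENNReal) (z, w)) w).symm
    _ = ∫⁻ t, ∫⁻ w, (incrRegion a).indicator (1 : ℝ × ℝ → ENNReal) (w - t, w) := by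
      refine lintegral_lintegral_swap (Measurable.aemeasurable ?_)
      exact hind.comp (by fun_prop : Measurable fun p : ℝ × ℝ => (p.1 - p.2, p.1))
    _ = _ := by
      simp_rw [hslice]
      rw [lintegral_indicator measurableSet_Ioi, lintegral_sectionLength ha0 ha1]


/-- The transition function `ω(a,·)` is integrable on `(−∞,0)` with
`∫_{−∞}^0 ω(a,z) dz = π²/(3(a²−1))`. -/
theorem stmt_6 (a : ℝ) (ha0 : 0 < a) (ha1 : a < 1)
    (psi0 psi1 : ℝ → ℝ)
    (hpsi0 : ∀ x, La a ≤ x → Ma a ≤ psi0 x ∧ fab a (psi0 x) = x)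
    (hpsi1 : ∀ x, La a ≤ x → x < 0 → psi1 x ≤ Ma a ∧ fab a (psi1 x) = x) :
    let ω : ℝ → ℝ := fun z => if z < Ma a then psi0 (fab a z) else psi1 (fab a z)
    MeasureTheory.IntegrableOn ω (Set.Iio 0) ∧
    (∫ z in Set.Iio 0, ω z) = Real.pi ^ 2 / (3 * (a ^ 2 - 1)) := by
  intro ω
  have hω : ∀ z < 0, volume (Prod.mk z ⁻¹' incrRegionSymm a) = ENNReal.ofReal (-ω z) ∧
      ω z < 0 := fun z hz => by
    have hL := La_le_fab ha0 ha1 z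
    have h0 := hpsi0 _ hL
    have h1 := hpsi1 _ hL ((fab_neg_iff ha0).2 hz)
    have hl : z < Ma a → Ma a ≤ ω z := fun h => by simpa [ω, h] using h0.1
    have hr : Ma a ≤ z → ω z ≤ Ma a := fun h => by simpa [ω, h.not_gt] using h1.1
    have hy : fab a (ω z) = fab a z := by
      by_cases h : z < Ma a
      · simpa [ω, h] using h0.2
      · simpa [ω, h] using h1.2
    refine ⟨volume_incrRegionSymm_slice ha0 ha1 hz hl hr hy, ?_⟩
    rw [← fab_neg_iff ha0, hy, fab_neg_iff ha0]
    exact hz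
  have hmem : ∀ᵐ z ∂volume.restrict (Iio (0 : ℝ)), z < 0 := ae_restrict_mem measurableSet_Iio
  have hnonneg : 0 ≤ᵐ[volume.restrict (Iio 0)] fun z => -ω z := by
    filter_upwards [hmem] with z hz
    exact neg_nonneg.2 (hω z hz).2.le
  have hmeas : AEStronglyMeasurable (fun z => -ω z) (volume.restrict (Iio 0)) := by
    refine (measurable_measure_prodMk_left (ν := volume)
      (measurableSet_incrRegionSymm a)).ennreal_toReal.aestronglyMeasurable.congr ?_
    filter_upwards [hmem] with z hz
    rw [(hω z hz).1, ENNReal.toReal_ofReal (neg_nonneg.2 (hω z hz).2.le)]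
  have ha2 : 0 < 1 - a ^ 2 := by nlinarith
  have hlint : ∫⁻ z in Iio 0, ENNReal.ofReal (-ω z) =
      ENNReal.ofReal (Real.pi ^ 2 / (3 * (1 - a ^ 2))) := by
    calc
      _ = ∫⁻ z in Iio 0, volume (Prod.mk z ⁻¹' incrRegionSymm a) :=
        setLIntegral_congr_fun measurableSet_Iio fun z hz => (hω z hz).1.symm
      _ = ∫⁻ z, volume (Prod.mk z ⁻¹' incrRegionSymm a) := by
        refine setLIntegral_eq_of_support_subset fun z hz => ?_
        by_contra h
        exact hz (by simp only [incrRegionSymm_slice_eq_empty (not_lt.1 h), measure_empty])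
      _ = volume (incrRegionSymm a) := by
        rw [Measure.volume_eq_prod, Measure.prod_apply (measurableSet_incrRegionSymm a)]
      _ = _ := by
        rw [volume_incrRegionSymm, volume_incrRegion ha0 ha1, ← ENNReal.ofReal_ofNat 2,
          ← ENNReal.ofReal_mul (by norm_num)]
        congr 1
        field_simp
        norm_num
  have hintegrable : IntegrableOn (fun z => -ω z) (Iio 0) := by
    refine ⟨hmeas, ?_⟩
    rw [hasFiniteIntegral_iff_ofReal hnonneg, hlint]
    exact ENNReal.ofReal_lt_top
  refine ⟨by simpa using hintegrable.neg, ?_⟩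
  have hneg : ∫ z in Iio 0, -ω z = Real.pi ^ 2 / (3 * (1 - a ^ 2)) := by
    rw [integral_eq_lintegral_of_nonneg_ae hnonneg hmeas, hlint,
      ENNReal.toReal_ofReal (by positivity)]
  rw [integral_neg] at hneg
  rw [neg_eq_iff_eq_neg.1 hneg, ← neg_sub 1 (a ^ 2), mul_neg, div_neg]
end
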